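/- arXiv:1102.5715 — 2 statements merged into one kernel-verified Lean document; each statement's English description precedes it below -/
import Mathlib

section
/- Let L ⊆ V^P be an isotropic subspace. Then the contiguity relation 'p ~ q iff p = q or L contains a vector v with supp v = {p, q}' is an equivalence relation on P. In particular, for pairwise distinct qubits p, q, r ∈ P and vectors v, w ∈ L with supp v = {p, q} and supp w = {q, r}, the isotropy of L forces v_q = w_q and hence supp(v + w) = {p, r}. -/
/- Common framework: binary stabilizer codes, local unitary/SO(3) automorphism groups. -/

noncomputable section
open scoped Matrix Real ComplexConjugate
open scoped Classical

namespace Stab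

/-- The one-qubit phase space `V = 𝔽₂ ⊕ 𝔽₂`, with first coordinate the `z`-component
and second coordinate the `x`-component. -/
abbrev V : Type := ZMod 2 × ZMod 2

/-- The symplectic form on `V`. -/
def omegaV (u v : V) : ZMod 2 := u.1 * v.2 + u.2 * v.1

/-- The phase space `V^P` over a set of qubits `P`. -/
abbrev QV (P : Type) := P → V

variable {P : Type} [Fintype P] [DecidableEq P]

/-- The direct-sum symplectic form on `V^P`. -/
def omega (u v : QV P) : ZMod 2 := ∑ p, omegaV (u p) (v p)

/-- A subspace `L ⊆ V^P` is isotropic if `ω` vanishes identically on `L × L`. -/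
def Isotropic (L : Submodule (ZMod 2) (QV P)) : Prop := ∀ u ∈ L, ∀ v ∈ L, omega u v = 0

/-- Support of a vector of `V^P`. -/
def supp (v : QV P) : Set P := {p | v p ≠ 0}

/-- The basis vector `z_p`. -/
def zvec (p : P) : QV P := Pi.single p ((1 : ZMod 2), (0 : ZMod 2))

/-- The basis vector `x_p`. -/
def xvec (p : P) : QV P := Pi.single p ((0 : ZMod 2), (1 : ZMod 2))

/-- Restriction (coordinate projection) of a vector to a subset `S ⊆ P`. -/
def restrTo (S : Set P) (v : QV P) : QV P := fun p => if p ∈ S then v p else 0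

/-- The coordinate subspace `V^S ⊆ V^P`. -/
def coordSub (S : Set P) : Submodule (ZMod 2) (QV P) where
  carrier := {v | ∀ p ∉ S, v p = 0}
  add_mem' := by intro a b ha hb p hp; simp [Pi.add_apply, ha p hp, hb p hp]
  zero_mem' := by intro p _; rfl
  smul_mem' := by intro c a ha p hp; simp [Pi.smul_apply, ha p hp]

/-- `L_S := L ∩ V^S`. -/
def LS (L : Submodule (ZMod 2) (QV P)) (S : Set P) : Submodule (ZMod 2) (QV P) :=
  L ⊓ coordSub S

/-- `L` splits as a direct factor on `S`, i.e. `L = L_S × L_{P∖S}`. -/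
def SplitsOn (L : Submodule (ZMod 2) (QV P)) (S : Set P) : Prop :=
  ∀ v ∈ L, restrTo S v ∈ L

/-- `L` splits off a zero factor: on some nonempty `S ⊆ P` all vectors of `L` vanish. -/
def HasZeroFactor (L : Submodule (ZMod 2) (QV P)) : Prop :=
  ∃ S : Set P, S.Nonempty ∧ ∀ v ∈ L, ∀ p ∈ S, v p = 0

/-- The qubit `p` is trivial: `L` splits off a one-dimensional factor on `{p}`. -/
def TrivialQubit (L : Submodule (ZMod 2) (QV P)) (p : P) : Prop :=
  SplitsOn L {p} ∧ ∃ v ∈ L, v ≠ 0 ∧ supp v ⊆ {p}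

/-- `L` splits off a trivial factor. -/
def HasTrivialFactor (L : Submodule (ZMod 2) (QV P)) : Prop :=
  ∃ p : P, TrivialQubit L p

/-- `L` splits off a Bell Lagrangian: an indecomposable Lagrangian direct factor on a
two-element set of qubits (all of whose nonzero vectors have full support `{p, q}`). -/
def HasBellFactor (L : Submodule (ZMod 2) (QV P)) : Prop :=
  ∃ p q : P, p ≠ q ∧ SplitsOn L {p, q} ∧
    ∃ v ∈ L, ∃ w ∈ L, v ≠ w ∧ supp v = {p, q} ∧ supp w = {p, q} ∧ supp (v + w) = {p, q}

/-- The factor `L_S` (for `S` in a partition) is indecomposable. -/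
def IndecompWithin (L : Submodule (ZMod 2) (QV P)) (S : Set P) : Prop :=
  ∀ T ⊆ S, SplitsOn L T → T = ∅ ∨ T = S

/-! ### The Hilbert space, Pauli operators and stabilizer codes -/

/-- The state space `ℋ^{⊗P} = (ℂ²)^{⊗P}`, realised concretely as functions on
computational basis labels. -/
abbrev HP (P : Type) := (P → Fin 2) → ℂ

/-- Operators on `ℋ^{⊗P}` as matrices. -/
abbrev MatP (P : Type) := Matrix (P → Fin 2) (P → Fin 2) ℂ

/-- The tensor (local) operator `⊗_{p} g_p` on `ℋ^{⊗P}`. -/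
def locOp (g : P → Matrix (Fin 2) (Fin 2) ℂ) : MatP P :=
  Matrix.of fun u w => ∏ p, g p (u p) (w p)

def sigmaX : Matrix (Fin 2) (Fin 2) ℂ := !![0, 1; 1, 0]
def sigmaY : Matrix (Fin 2) (Fin 2) ℂ := !![0, -Complex.I; Complex.I, 0]
def sigmaZ : Matrix (Fin 2) (Fin 2) ℂ := !![1, 0; 0, -1]

/-- The one-qubit Pauli operator `Z^a X^b` attached to `(a, b) ∈ V`. -/
def pauliMat (v : V) : Matrix (Fin 2) (Fin 2) ℂ := sigmaZ ^ (v.1 : ZMod 2).val * sigmaX ^ (v.2 : ZMod 2).val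

/-- The Pauli (Weyl) operator attached to `v ∈ V^P`. -/
def Wop (v : QV P) : MatP P := locOp fun p => pauliMat (v p)

/-- A group-homomorphic section `σ` over `L` of the projection from the Pauli group
`Ṽ^P` onto `V^P`: each value `σ(v)` is a unitary scalar multiple of the Pauli operator
`W(v)`, and `σ` is multiplicative on `L`. -/
structure PauliSection (L : Submodule (ZMod 2) (QV P)) where
  toFun : QV P → MatP P
  scalar : ∀ v : QV P, ∃ c : ℂ, toFun v = c • Wop v
  unitary : ∀ v : QV P, toFun v ∈ Matrix.unitaryGroup (P → Fin 2) ℂ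
  mul_of_mem : ∀ u ∈ L, ∀ v ∈ L, toFun (u + v) = toFun u * toFun v
  map_zero : toFun 0 = 1

/-- The stabilizer code `C(L, σ)`: the common fixed-point space of the stabilizer
group `σ(L)`. -/
def code (L : Submodule (ZMod 2) (QV P)) (σ : PauliSection L) : Submodule ℂ (HP P) where
  carrier := {ψ | ∀ v ∈ L, σ.toFun v *ᵥ ψ = ψ}
  add_mem' := by intro a b ha hb v hv; rw [Matrix.mulVec_add, ha v hv, hb v hv]
  zero_mem' := by intro v hv; simp
  smul_mem' := by intro c a ha v hv; rw [Matrix.mulVec_smul, ha v hv]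

/-- The standard section: `σ(v) = W(v)` on `L`. -/
def StandardOn (L : Submodule (ZMod 2) (QV P)) (σ : PauliSection L) : Prop :=
  ∀ v ∈ L, σ.toFun v = Wop v

/-! ### `SO(3)`, rotations, and the automorphism group of a code -/

/-- `3×3` real matrices. -/
abbrev Rot : Type := Matrix (Fin 3) (Fin 3) ℝ

/-- `SO(3)` as a set of `3×3` real matrices. -/
def SO3 : Set Rot := {A | A * Aᵀ = 1 ∧ A.det = 1}

/-- The ordered Pauli basis (x, y, z) of traceless Hermitian `2×2` matrices. -/
def pauliBasis : Fin 3 → Matrix (Fin 2) (Fin 2) ℂ := ![sigmaX, sigmaY, sigmaZ]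

/-- The image of a unitary `u ∈ U(2)` in `SO(3)` under the adjoint action on traceless
Hermitian operators (the identification `U(2)/S¹ = SO(3)`):
`u σ_j u† = Σ_i (adjRot u)_{ij} σ_i`. -/
def adjRot (u : Matrix (Fin 2) (Fin 2) ℂ) : Rot :=
  Matrix.of fun i j =>
    (1 / 2 : ℝ) * ((pauliBasis i * u * pauliBasis j * u.conjTranspose).trace).re

/-- Rotation about the `x`-axis by angle `θ`. -/
def rotX (θ : ℝ) : Rot := !![1, 0, 0; 0, Real.cos θ, -Real.sin θ; 0, Real.sin θ, Real.cos θ]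

/-- Rotation about the `y`-axis by angle `θ`. -/
def rotY (θ : ℝ) : Rot := !![Real.cos θ, 0, Real.sin θ; 0, 1, 0; -Real.sin θ, 0, Real.cos θ]

/-- Rotation about the `z`-axis by angle `θ`. -/
def rotZ (θ : ℝ) : Rot := !![Real.cos θ, -Real.sin θ, 0; Real.sin θ, Real.cos θ, 0; 0, 0, 1]

/-- The circle group `C_x ⊆ SO(3)` of rotations about the `x`-axis. -/
def Cx : Set Rot := Set.range rotX

/-- The circle group `C_y ⊆ SO(3)` of rotations about the `y`-axis. -/
def Cy : Set Rot := Set.range rotY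

/-- The circle group `C_z ⊆ SO(3)` of rotations about the `z`-axis. -/
def Cz : Set Rot := Set.range rotZ

/-- The octahedral group: the subgroup of `SO(3)` generated by the rotations by a right
angle about the three coordinate axes. -/
def octahedral : Set Rot :=
  (Submonoid.closure {rotX (π / 2), rotY (π / 2), rotZ (π / 2)} : Submonoid Rot)

/-- The infinite dihedral group `D_x ⊆ SO(3)`. -/
def Dx : Set Rot := (Submonoid.closure (Cx ∪ {rotZ π}) : Submonoid Rot)

/-- The infinite dihedral group `D_y ⊆ SO(3)`. -/
def Dy : Set Rot := (Submonoid.closure (Cy ∪ {rotZ π}) : Submonoid Rot)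

/-- The infinite dihedral group `D_z ⊆ SO(3)`. -/
def Dz : Set Rot := (Submonoid.closure (Cz ∪ {rotX π}) : Submonoid Rot)

/-- The automorphism group `A(L, σ) ⊆ SO(3)^P` of the stabilizer code `C(L, σ)`:
all families of rotations admitting a local unitary lift mapping the code into itself. -/
def autSet (L : Submodule (ZMod 2) (QV P)) (σ : PauliSection L) : Set (P → Rot) :=
  {g | ∃ u : P → Matrix (Fin 2) (Fin 2) ℂ,
        (∀ p, u p ∈ Matrix.unitaryGroup (Fin 2) ℂ) ∧
        (∀ p, adjRot (u p) = g p) ∧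
        ∀ ψ ∈ code L σ, locOp u *ᵥ ψ ∈ code L σ}

/-- The automorphism group `A(L, σ)_p` at the qubit `p`. -/
def autSetAt (L : Submodule (ZMod 2) (QV P)) (σ : PauliSection L) (p : P) : Set Rot :=
  (fun g => g p) '' autSet L σ

/-- The normal subgroup `Z(L, σ)` of automorphisms acting by a scalar on the code. -/
def zSet (L : Submodule (ZMod 2) (QV P)) (σ : PauliSection L) : Set (P → Rot) :=
  {g | ∃ u : P → Matrix (Fin 2) (Fin 2) ℂ,
        (∀ p, u p ∈ Matrix.unitaryGroup (Fin 2) ℂ) ∧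
        (∀ p, adjRot (u p) = g p) ∧
        ∃ c : ℂ, ∀ ψ ∈ code L σ, locOp u *ᵥ ψ = c • ψ}

/-! ### Restriction to subsets of qubits -/

/-- Restriction of a phase-space vector to the qubits of `S`. -/
def resQV (S : Set P) (v : QV P) : QV ↥S := fun s => v s

/-- Restriction as a linear map. -/
def resLin (S : Set P) : QV P →ₗ[ZMod 2] QV ↥S where
  toFun := resQV S
  map_add' := by intros; rfl
  map_smul' := by intros; rfl

/-- `L_S`, regarded as a subspace of `V^S`. -/
def LSsub (L : Submodule (ZMod 2) (QV P)) (S : Set P) : Submodule (ZMod 2) (QV ↥S) :=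
  Submodule.map (resLin S) (LS L S)

/-- The extension `M ⊗ 1` to `ℋ^{⊗P}` of an operator `M` on `ℋ^{⊗S}`. -/
def extendOp (S : Set P) (M : Matrix (↥S → Fin 2) (↥S → Fin 2) ℂ) : MatP P :=
  Matrix.of fun u w =>
    if ∀ p ∉ S, u p = w p then M (fun s => u s) (fun s => w s) else 0

/-- `σ'` is the restriction `σ|_{L_S}` of the section `σ` to `L_S`. -/
def RestrictedSection (L : Submodule (ZMod 2) (QV P)) (σ : PauliSection L) (S : Set P)
    (σ' : PauliSection (LSsub L S)) : Prop :=
  ∀ v ∈ LS L S, extendOp S (σ'.toFun (resQV S v)) = σ.toFun v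

/-! ### Contiguity, protected and gauge qubits, and normal forms -/

/-- Two qubits are contiguous if they are equal or `L` contains a vector supported
exactly on the pair. -/
def Contig (L : Submodule (ZMod 2) (QV P)) (p q : P) : Prop :=
  p = q ∨ ∃ v ∈ L, supp v = ({p, q} : Set P)

/-- The contiguity class of a qubit. -/
def contigClass (L : Submodule (ZMod 2) (QV P)) (p : P) : Set P := {q | Contig L p q}

/-- The qubit `p` is protected: the projection `L → V^{{p}}` is surjective. -/
def IsProtected (L : Submodule (ZMod 2) (QV P)) (p : P) : Prop :=
  ∀ w : V, ∃ v ∈ L, v p = w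

/-- The qubit `p` is of gauge type: the projection `L → V^{{p}}` has a line as image. -/
def IsGauge (L : Submodule (ZMod 2) (QV P)) (p : P) : Prop :=
  ¬ IsProtected L p ∧ ∃ v ∈ L, v p ≠ 0

/-- The subspace `⟨z_a + z_b : a ≠ b ∈ S⟩`. -/
def zspan (S : Set P) : Submodule (ZMod 2) (QV P) :=
  Submodule.span (ZMod 2) {w | ∃ a ∈ S, ∃ b ∈ S, a ≠ b ∧ w = zvec a + zvec b}

/-- The vector `Σ_{s ∈ S} x_s`. -/
def xsumOn (S : Set P) : QV P := S.indicator fun _ => ((0 : ZMod 2), (1 : ZMod 2))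

/-- Normal form of `L` (conclusion of the normalisation lemma): every contiguity class `S`
carries either `⟨z_a + z_b⟩` or `⟨z_a + z_b⟩ + ⟨Σ_{s∈S} x_s⟩`. -/
def NormalForm (L : Submodule (ZMod 2) (QV P)) : Prop :=
  ∀ p : P,
    LS L (contigClass L p) = zspan (contigClass L p) ∨
    LS L (contigClass L p) =
      zspan (contigClass L p) ⊔ Submodule.span (ZMod 2) {xsumOn (contigClass L p)}

/-- The pair `(L, σ)` is normalised. -/
def Normalised (L : Submodule (ZMod 2) (QV P)) (σ : PauliSection L) : Prop :=
  NormalForm L ∧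
  (∀ p : P, IsGauge L p → contigClass L p = {p} → ∀ v ∈ L, (v p).2 = 0) ∧
  (∀ p : P, IsProtected L p → contigClass L p = {p} →
    connectedComponentIn (autSetAt L σ p) 1 ⊆ Cz) ∧
  (∀ p : P, IsProtected L p → contigClass L p ≠ {p} →
    LS L (contigClass L p) = zspan (contigClass L p) →
    ∃ v ∈ L, ∀ s ∈ contigClass L p, v s = ((0 : ZMod 2), (1 : ZMod 2))) ∧
  (∀ p q : P, p ≠ q → Contig L p q →
    σ.toFun (zvec p + zvec q) = Wop (zvec p + zvec q))

/-- A local symplectic family of automorphisms of `V`. -/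
def IsLocalSymp (f : P → (V ≃ₗ[ZMod 2] V)) : Prop :=
  ∀ (p : P) (u v : V), omegaV (f p u) (f p v) = omegaV u v

/-- The image of `L` under a local (symplectic) transformation. -/
def mapL (L : Submodule (ZMod 2) (QV P)) (f : P → (V ≃ₗ[ZMod 2] V)) :
    Submodule (ZMod 2) (QV P) :=
  Submodule.map (LinearEquiv.piCongrRight f : QV P ≃ₗ[ZMod 2] QV P).toLinearMap L

/-! ### Abstract group structures carried by subsets of a monoid -/

/-- The set `s` carries the structure of a solvable group. -/
structure SolvableGroupStructure (M : Type) [Monoid M] (s : Set M) where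
  G : Type
  [grp : Group G]
  solv : IsSolvable G
  f : G → M
  inj : Function.Injective f
  map_mul : ∀ a b : G, f (a * b) = f a * f b
  range_eq : Set.range f = s

/-- The quotient of the group (carried by) `A` by the normal subgroup (carried by) `Z`
is a compact solvable topological (Lie) group. -/
structure CompactSolvableQuotientStructure (M : Type) [Monoid M] [TopologicalSpace M]
    (A Z : Set M) where
  G : Type
  [grp : Group G]
  [top : TopologicalSpace G]
  [tgrp : IsTopologicalGroup G]
  cpt : CompactSpace G
  solv : IsSolvable G
  φ : M → G
  cont : ContinuousOn φ A
  map_mul' : ∀ a ∈ A, ∀ b ∈ A, φ (a * b) = φ a * φ b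
  surj : ∀ y : G, ∃ a ∈ A, φ a = y
  ker : ∀ a ∈ A, (φ a = 1 ↔ a ∈ Z)

/-! ### Logical qubits and transversally realisable gates -/

/-- The standard hermitian inner product on a finite-dimensional function space. -/
def innerF {ι : Type} [Fintype ι] (ψ φ : ι → ℂ) : ℂ := ∑ i, (starRingEnd ℂ) (ψ i) * φ i

/-- `e` is a unitary identification of the code space with a space of logical qubits. -/
def IsUnitaryEquiv (L : Submodule (ZMod 2) (QV P)) (σ : PauliSection L) {d : ℕ}
    (e : ↥(code L σ) ≃ₗ[ℂ] HP (Fin d)) : Prop :=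
  ∀ ψ φ : ↥(code L σ),
    innerF (e ψ) (e φ) = innerF (ψ : HP P) (φ : HP P)

/-- The operator acting as `w` on the logical qubit `k` and trivially elsewhere. -/
def oneQubitOp (d : ℕ) (k : Fin d) (w : Matrix (Fin 2) (Fin 2) ℂ) : MatP (Fin d) :=
  locOp fun j => if j = k then w else 1

/-- The set of rotations in `SO(3)` induced, via the identification `e`, on a fixed
logical qubit `k` by (exactly realised) transversal gates, i.e. by elements of `A(L, σ)`. -/
def logicalSet (L : Submodule (ZMod 2) (QV P)) (σ : PauliSection L) {d : ℕ}
    (e : ↥(code L σ) ≃ₗ[ℂ] HP (Fin d)) (k : Fin d) : Set Rot :=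
  {A | ∃ w ∈ Matrix.unitaryGroup (Fin 2) ℂ, adjRot w = A ∧
        ∃ u : P → Matrix (Fin 2) (Fin 2) ℂ,
          (∀ p, u p ∈ Matrix.unitaryGroup (Fin 2) ℂ) ∧
          ∀ φ : HP (Fin d),
            locOp u *ᵥ ((e.symm φ : HP P)) = ((e.symm (oneQubitOp d k w *ᵥ φ) : HP P))}

/-! ### Reed–Muller codes -/

/-- The qubit set `P = 𝔽₂^m ∖ {0}`. -/
abbrev RMQubits (m : ℕ) := {s : Fin m → ZMod 2 // s ≠ 0}

/-- Polynomial functions on `𝔽₂^m` of degree at most `r` with zero constant term. -/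
def RMspan (r m : ℕ) : Submodule (ZMod 2) ((Fin m → ZMod 2) → ZMod 2) :=
  Submodule.span (ZMod 2)
    {f | ∃ I : Finset (Fin m), I.Nonempty ∧ I.card ≤ r ∧ f = fun s => ∏ i ∈ I, s i}

/-- The shortened Reed–Muller code `R_*(r, m) ⊆ 𝔽₂^P`. -/
def RMstar (r m : ℕ) : Submodule (ZMod 2) (RMQubits m → ZMod 2) :=
  Submodule.map (LinearMap.funLeft (ZMod 2) (ZMod 2) Subtype.val) (RMspan r m)

/-- The `z`-part of a phase-space vector. -/
def zPart {P : Type} : QV P →ₗ[ZMod 2] (P → ZMod 2) where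
  toFun v := fun p => (v p).1
  map_add' := by intros; rfl
  map_smul' := by intros; rfl

/-- The `x`-part of a phase-space vector. -/
def xPart {P : Type} : QV P →ₗ[ZMod 2] (P → ZMod 2) where
  toFun v := fun p => (v p).2
  map_add' := by intros; rfl
  map_smul' := by intros; rfl

/-- The Calderbank–Shor–Steane isotropic subspace built from the shortened Reed–Muller
codes `R_*(m−2, m)` (in the `z`-coordinates) and `R_*(1, m)` (in the `x`-coordinates). -/
def cssL (m : ℕ) : Submodule (ZMod 2) (QV (RMQubits m)) :=
  Submodule.comap zPart (RMstar (m - 2) m) ⊓ Submodule.comap xPart (RMstar 1 m)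

/-- The stabilizer state `|0⟩_S ⊗ |0⟩_T + |0⟩_S ⊗ |1⟩_T + |1⟩_S ⊗ |0⟩_T − |1⟩_S ⊗ |1⟩_T`
(with `T = Sᶜ`), written in the computational basis. -/
def bellLike (S : Set P) (p q : P) : HP P := fun u =>
  if (∀ a ∈ S, u a = u p) ∧ (∀ a ∈ Sᶜ, u a = u q) then
    ((-1 : ℂ)) ^ ((u p : Fin 2).val * (u q : Fin 2).val) else 0


/-- A nondegenerate alternating form on a plane over `𝔽₂` separates distinct nonzero vectors. -/
lemma eq_of_omegaV_eq_zero :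
    ∀ u v : V, u ≠ 0 → v ≠ 0 → omegaV u v = 0 → u = v := by
  unfold omegaV
  decide

lemma mem_supp {P : Type} {v : QV P} {s : P} : s ∈ supp v ↔ v s ≠ 0 := Iff.rfl

/-- If the supports of `u` and `v` meet in exactly one point, only that point contributes
to `ω(u, v)`. -/
lemma omega_eq_of_supp_inter {P : Type} [Fintype P] {u v : QV P} {q : P} (h : supp u ∩ supp v ⊆ {q}) :
    omega u v = omegaV (u q) (v q) := by
  refine Finset.sum_eq_single q (fun s _ hs => ?_) (by simp)
  by_cases hu : u s = 0
  · simp [omegaV, hu]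
  · have hv : v s = 0 := by_contra fun hv => hs (h ⟨hu, hv⟩)
    simp [omegaV, hv]

/-- Vectors of an isotropic subspace whose supports meet exactly in `q` agree at `q`. -/
lemma Isotropic.apply_eq_of_supp_inter {P : Type} [Fintype P]
    {L : Submodule (ZMod 2) (QV P)} (hL : Isotropic L)
    {v w : QV P} (hv : v ∈ L) (hw : w ∈ L) {q : P} (h : supp v ∩ supp w = {q}) :
    v q = w q := by
  have hq : q ∈ supp v ∩ supp w := h ▸ rfl
  exact eq_of_omegaV_eq_zero _ _ hq.1 hq.2 (omega_eq_of_supp_inter h.subset ▸ hL v hv w hw)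

/-- If `v` and `w` agree wherever both are nonzero, then `supp (v + w)` is the symmetric
difference of the supports. -/
lemma supp_add_eq_symmDiff {P : Type} {v w : QV P} (h : ∀ s ∈ supp v ∩ supp w, v s = w s) :
    supp (v + w) = symmDiff (supp v) (supp w) := by
  ext s
  have hs := h s
  simp only [Set.mem_inter_iff, Set.mem_symmDiff, mem_supp, Pi.add_apply] at hs ⊢
  by_cases hv : v s = 0 <;> by_cases hw : w s = 0 <;>
    simp_all [ZModModule.add_self]

/-- In an isotropic subspace, two vectors supported on pairs sharing exactly one qubit agree
there, and their sum is supported on the two other qubits. -/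
lemma Isotropic.apply_eq_and_supp_add {P : Type} [Fintype P]
    {L : Submodule (ZMod 2) (QV P)} (hL : Isotropic L)
    {p q r : P} (hpq : p ≠ q) (hqr : q ≠ r) (hpr : p ≠ r) {v w : QV P}
    (hv : v ∈ L) (hw : w ∈ L) (hsv : supp v = {p, q}) (hsw : supp w = {q, r}) :
    v q = w q ∧ supp (v + w) = {p, r} := by
  have hinter : supp v ∩ supp w = {q} := by
    ext s
    simp only [hsv, hsw, Set.mem_inter_iff, Set.mem_insert_iff, Set.mem_singleton_iff]
    grind
  have hq := hL.apply_eq_of_supp_inter hv hw hinter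
  refine ⟨hq, ?_⟩
  rw [supp_add_eq_symmDiff (by simp [hinter, hq]), hsv, hsw]
  ext s
  simp only [Set.mem_symmDiff, Set.mem_insert_iff, Set.mem_singleton_iff]
  grind

/-- **Contiguity is an equivalence relation.** Let `L ⊆ V^P` be isotropic. Then the
contiguity relation is an equivalence relation on `P`; in particular, for pairwise
distinct `p, q, r` and `v, w ∈ L` with `supp v = {p, q}` and `supp w = {q, r}`, the
isotropy of `L` forces `v_q = w_q` and hence `supp (v + w) = {p, r}`. -/
theorem contiguity_equivalence {P : Type} [Fintype P] [DecidableEq P]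
    (L : Submodule (ZMod 2) (QV P)) (hL : Isotropic L) :
    Equivalence (Contig L) ∧
    ∀ p q r : P, p ≠ q → q ≠ r → p ≠ r →
      ∀ v ∈ L, ∀ w ∈ L, supp v = ({p, q} : Set P) → supp w = ({q, r} : Set P) →
        v q = w q ∧ supp (v + w) = ({p, r} : Set P) := by
  refine ⟨⟨fun _ => Or.inl rfl, ?_, ?_⟩, fun p q r hpq hqr hpr v hv w hw hsv hsw =>
    hL.apply_eq_and_supp_add hpq hqr hpr hv hw hsv hsw⟩
  · rintro p q (rfl | ⟨v, hv, hsv⟩)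
    · exact Or.inl rfl
    · exact Or.inr ⟨v, hv, hsv.trans (Set.pair_comm p q)⟩
  · rintro p q r (rfl | ⟨v, hv, hsv⟩) hqr
    · exact hqr
    obtain rfl | ⟨w, hw, hsw⟩ := hqr
    · exact Or.inr ⟨v, hv, hsv⟩
    by_cases hpr : p = r
    · exact Or.inl hpr
    by_cases hpq : p = q
    · exact Or.inr ⟨w, hw, hpq ▸ hsw⟩
    by_cases hqr : q = r
    · exact Or.inr ⟨v, hv, hqr ▸ hsv⟩
    exact Or.inr ⟨v + w, L.add_mem hv hw,
      (hL.apply_eq_and_supp_add hpq hqr hpr hv hw hsv hsw).2⟩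

end Stab
end
end

section
/- Every isotropic subspace L ⊆ V^P has a unique representation L = ∏_{S∈𝒫} L_S as a direct product, where 𝒫 is a partition of P and each factor L_S ⊆ V^S is indecomposable. Moreover the stabilizer code and the automorphism group decompose accordingly: C(L,σ) = ⊗_{S∈𝒫} C(L_S, σ|_{L_S}) and A(L,σ) = ∏_{S∈𝒫} A(L_S, σ|_{L_S}). -/
/- Common framework: binary stabilizer codes, local unitary/SO(3) automorphism groups. -/

noncomputable section
open scoped Matrix Real ComplexConjugate
open scoped Classical

namespace Stab

variable {P : Type} [Fintype P] [DecidableEq P]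

/-! ### Sets on which `L` splits -/

section Splitting

variable {P : Type}

theorem SplitsOn.compl {L : Submodule (ZMod 2) (QV P)} {S : Set P} (h : SplitsOn L S) :
    SplitsOn L Sᶜ := by
  intro v hv
  have : restrTo Sᶜ v = v - restrTo S v := by
    funext p
    by_cases hp : p ∈ S <;> simp [restrTo, hp]
  rw [this]
  exact L.sub_mem hv (h v hv)

theorem SplitsOn.inter {L : Submodule (ZMod 2) (QV P)} {S T : Set P} (hS : SplitsOn L S)
    (hT : SplitsOn L T) : SplitsOn L (S ∩ T) := by
  intro v hv
  have : restrTo (S ∩ T) v = restrTo S (restrTo T v) := by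
    funext p
    by_cases hp : p ∈ S <;> by_cases hq : p ∈ T <;> simp [restrTo, hp, hq]
  rw [this]
  exact hS _ (hT v hv)

theorem splitsOn_univ (L : Submodule (ZMod 2) (QV P)) : SplitsOn L Set.univ := by
  intro v hv
  have : restrTo Set.univ v = v := by
    funext p
    simp [restrTo]
  rwa [this]

theorem SplitsOn.sInter {L : Submodule (ZMod 2) (QV P)} {A : Set (Set P)} (hA : A.Finite)
    (h : ∀ S ∈ A, SplitsOn L S) : SplitsOn L (⋂₀ A) := by
  induction A, hA using Set.Finite.induction_on with
  | empty => simpa using splitsOn_univ L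
  | insert _ _ ih =>
    rw [Set.sInter_insert]
    exact (h _ (Set.mem_insert _ _)).inter (ih fun S hS => h S (Set.mem_insert_of_mem _ hS))

/-- Two qubits are inseparable if no splitting of `L` separates them. -/
def inseparableSetoid (L : Submodule (ZMod 2) (QV P)) : Setoid P where
  r p q := ∀ S, SplitsOn L S → (p ∈ S ↔ q ∈ S)
  iseqv := ⟨fun _ _ _ => Iff.rfl, fun h S hS => (h S hS).symm,
    fun h h' S hS => (h S hS).trans (h' S hS)⟩

theorem inseparable_class_subset {L : Submodule (ZMod 2) (QV P)} {S : Set P} {p : P}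
    (hS : SplitsOn L S) (hp : p ∈ S) : {q | inseparableSetoid L q p} ⊆ S :=
  fun _ hq => (hq S hS).2 hp

theorem splitsOn_inseparable_class [Finite P] (L : Submodule (ZMod 2) (QV P)) (p : P) :
    SplitsOn L {q | inseparableSetoid L q p} := by
  have : {q | inseparableSetoid L q p} = ⋂₀ {S | SplitsOn L S ∧ p ∈ S} := by
    refine Set.Subset.antisymm
      (Set.subset_sInter fun S hS => inseparable_class_subset hS.1 hS.2) ?_
    intro q hq S hS
    refine ⟨fun hqS => ?_, fun hpS => hq S ⟨hS, hpS⟩⟩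
    by_contra hpS
    exact hq Sᶜ ⟨hS.compl, hpS⟩ hqS
  rw [this]
  exact SplitsOn.sInter (Set.toFinite _) fun S hS => hS.1

theorem indecompWithin_inseparable_class (L : Submodule (ZMod 2) (QV P)) (p : P) :
    IndecompWithin L {q | inseparableSetoid L q p} := by
  intro T hT hs
  rcases T.eq_empty_or_nonempty with h | ⟨t, ht⟩
  · exact Or.inl h
  · refine Or.inr (hT.antisymm fun q hq => ?_)
    exact (((inseparableSetoid L).trans hq ((inseparableSetoid L).symm (hT ht))) T hs).2 ht

theorem eq_classes_of_isPartition [Finite P] {L : Submodule (ZMod 2) (QV P)} {parts : Set (Set P)}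
    (hp : Setoid.IsPartition parts)
    (h : ∀ S ∈ parts, SplitsOn L S ∧ IndecompWithin L S) :
    parts = (inseparableSetoid L).classes := by
  have key : ∀ S ∈ parts, ∀ p ∈ S, {q | inseparableSetoid L q p} = S := by
    intro S hS p hpS
    refine ((h S hS).2 _ (inseparable_class_subset (h S hS).1 hpS)
      (splitsOn_inseparable_class L p)).resolve_left ?_
    exact Set.Nonempty.ne_empty ⟨p, (inseparableSetoid L).refl p⟩
  ext S
  constructor
  · intro hS
    obtain ⟨p, hpS⟩ := Setoid.nonempty_of_mem_partition hp hS
    exact ⟨p, (key S hS p hpS).symm⟩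
  · rintro ⟨p, rfl⟩
    obtain ⟨S, ⟨hS, hpS⟩, -⟩ := hp.2 p
    rw [key S hS p hpS]
    exact hS

end Splitting

/-! ### Local operators -/

theorem locOp_mul (g h : P → Matrix (Fin 2) (Fin 2) ℂ) :
    locOp g * locOp h = locOp fun p => g p * h p := by
  ext u w
  simp only [locOp, Matrix.mul_apply, Matrix.of_apply, ← Finset.prod_mul_distrib]
  rw [Finset.prod_univ_sum]
  simp

theorem locOp_one {P : Type} [Fintype P] : locOp (fun _ : P => (1 : Matrix (Fin 2) (Fin 2) ℂ)) = 1 := by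
  ext u w
  simp only [locOp, Matrix.of_apply, Matrix.one_apply, Finset.prod_boole]
  simp [funext_iff]

theorem locOp_smul {P : Type} [Fintype P] (c : P → ℂ) (g : P → Matrix (Fin 2) (Fin 2) ℂ) :
    locOp (fun p => c p • g p) = (∏ p, c p) • locOp g := by
  ext u w
  simp [locOp, Finset.prod_mul_distrib]

theorem pauliMat_zero : pauliMat 0 = 1 := by
  simp [pauliMat]

/-- The function `f` depends only on the qubits of `S`. -/
def LocalOn (S : Set P) (f : HP P) : Prop :=
  ∀ u u' : P → Fin 2, (∀ p ∈ S, u p = u' p) → f u = f u'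

theorem locOp_mulVec_mul {S : Set P} {g : P → Matrix (Fin 2) (Fin 2) ℂ}
    (hg : ∀ p ∉ S, g p = 1) (f : HP P) {h : HP P} (hh : LocalOn Sᶜ h) :
    locOp g *ᵥ (f * h) = (locOp g *ᵥ f) * h := by
  funext u
  simp only [Matrix.mulVec, dotProduct, Pi.mul_apply, Finset.sum_mul]
  refine Finset.sum_congr rfl fun w _ => ?_
  by_cases huw : ∀ p ∈ Sᶜ, u p = w p
  · rw [hh u w huw, mul_assoc]
  · push Not at huw
    obtain ⟨p, hp, hne⟩ := huw
    have : locOp g u w = 0 :=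
      Finset.prod_eq_zero (Finset.mem_univ p) (by rw [hg p hp, Matrix.one_apply_ne hne])
    simp [this]

theorem LocalOn.locOp_mulVec {S : Set P} {g : P → Matrix (Fin 2) (Fin 2) ℂ}
    (hg : ∀ p ∉ S, g p = 1) {f : HP P} (hf : LocalOn S f) : LocalOn S (locOp g *ᵥ f) := by
  intro u u' huu'
  simp only [Matrix.mulVec, dotProduct]
  refine Fintype.sum_equiv (Equiv.piCongrRight fun p => Equiv.swap (u p) (u' p)) _ _ fun w => ?_
  congr 1
  · simp only [locOp, Matrix.of_apply, Equiv.piCongrRight_apply, Pi.map_apply]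
    refine Finset.prod_congr rfl fun p _ => ?_
    by_cases hp : p ∈ S
    · simp [huu' p hp]
    · have : u' p = Equiv.swap (u p) (u' p) (w p) ↔ u p = w p := by
        conv_lhs => lhs; rw [← Equiv.swap_apply_left (u p) (u' p)]
        exact (Equiv.swap (u p) (u' p)).injective.eq_iff
      rw [hg p hp, Matrix.one_apply, Matrix.one_apply]
      simp only [this]
  · refine hf _ _ fun p hp => ?_
    simp [huu' p hp]

/-! ### Sections and codes -/

section Code

variable {L : Submodule (ZMod 2) (QV P)} (σ : PauliSection L)

theorem PauliSection.exists_locOp {S : Set P} {v : QV P} (hv : v ∈ coordSub S) :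
    ∃ (c : ℂ) (g : P → Matrix (Fin 2) (Fin 2) ℂ),
      (∀ p ∉ S, g p = 1) ∧ σ.toFun v = c • locOp g := by
  obtain ⟨c, hc⟩ := σ.scalar v
  exact ⟨c, _, fun p hp => by rw [hv p hp, pauliMat_zero], hc⟩

theorem PauliSection.mulVec_mul {S : Set P} {v : QV P} (hv : v ∈ coordSub S) (f : HP P)
    {h : HP P} (hh : LocalOn Sᶜ h) : σ.toFun v *ᵥ (f * h) = (σ.toFun v *ᵥ f) * h := by
  obtain ⟨c, g, hg, hc⟩ := σ.exists_locOp hv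
  rw [hc, Matrix.smul_mulVec, Matrix.smul_mulVec, locOp_mulVec_mul hg f hh, smul_mul_assoc]

theorem PauliSection.localOn_mulVec {S : Set P} {v : QV P} (hv : v ∈ coordSub S) {f : HP P}
    (hf : LocalOn S f) : LocalOn S (σ.toFun v *ᵥ f) := by
  obtain ⟨c, g, hg, hc⟩ := σ.exists_locOp hv
  intro u u' h
  rw [hc, Matrix.smul_mulVec, Pi.smul_apply, Pi.smul_apply, hf.locOp_mulVec hg u u' h]

theorem PauliSection.commute_locOp {S : Set P} {v : QV P} (hv : v ∈ coordSub S)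
    {g : P → Matrix (Fin 2) (Fin 2) ℂ} (hg : ∀ p ∈ S, g p = 1) :
    σ.toFun v * locOp g = locOp g * σ.toFun v := by
  obtain ⟨c, k, hk, hc⟩ := σ.exists_locOp hv
  rw [hc, smul_mul_assoc, mul_smul_comm, locOp_mul, locOp_mul]
  congr 2
  funext p
  by_cases hp : p ∈ S
  · simp [hg p hp]
  · simp [hk p hp]

/-- The unnormalised projector onto the vectors fixed by `σ(L_S)`. -/
def stabSum (S : Set P) : MatP P := ∑ v : ↥(LS L S), σ.toFun v

theorem mul_stabSum {S : Set P} {v : QV P} (hv : v ∈ LS L S) :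
    σ.toFun v * stabSum σ S = stabSum σ S := by
  rw [stabSum, Finset.mul_sum]
  refine Fintype.sum_equiv (Equiv.addLeft (⟨v, hv⟩ : ↥(LS L S))) _ _ fun w => ?_
  exact (σ.mul_of_mem v hv.1 w w.2.1).symm

theorem stabSum_mulVec_of_mem_code (S : Set P) {ψ : HP P} (hψ : ψ ∈ code L σ) :
    stabSum σ S *ᵥ ψ = (Fintype.card ↥(LS L S) : ℂ) • ψ := by
  rw [stabSum, Matrix.sum_mulVec, Finset.sum_congr rfl fun v _ => hψ v.1 v.2.1,
    Finset.sum_const, Finset.card_univ, Nat.cast_smul_eq_nsmul]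

theorem stabSum_mulVec_mul (S : Set P) (f : HP P) {h : HP P} (hh : LocalOn Sᶜ h) :
    stabSum σ S *ᵥ (f * h) = (stabSum σ S *ᵥ f) * h := by
  rw [stabSum, Matrix.sum_mulVec, Matrix.sum_mulVec, Finset.sum_mul]
  exact Finset.sum_congr rfl fun v _ => σ.mulVec_mul v.2.2 f hh

theorem localOn_stabSum_mulVec {S : Set P} {f : HP P} (hf : LocalOn S f) :
    LocalOn S (stabSum σ S *ᵥ f) := by
  intro u u' h
  rw [stabSum, Matrix.sum_mulVec, Finset.sum_apply, Finset.sum_apply]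
  exact Finset.sum_congr rfl fun v _ => σ.localOn_mulVec v.2.2 hf u u' h

theorem localOn_compl_prod_erase {P : Type} {Q : Finset (Set P)}
    (hQ : (Q : Set (Set P)).PairwiseDisjoint id) {f : Set P → HP P}
    (hf : ∀ S ∈ Q, LocalOn S (f S)) {T : Set P} (hT : T ∈ Q) :
    LocalOn Tᶜ (∏ S ∈ Q.erase T, f S) := by
  intro u u' h
  rw [Finset.prod_apply, Finset.prod_apply]
  refine Finset.prod_congr rfl fun S hS => ?_
  obtain ⟨hne, hSQ⟩ := Finset.mem_erase.1 hS
  exact hf S hSQ u u' fun p hp => h p fun hpT =>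
    Set.disjoint_left.1 (hQ hSQ hT hne) hp hpT

/-- Products over `Q` of functions local on the members `S` of `Q`, the factors with `S ∈ F`
being fixed by `σ(L_S)`. -/
def productStates (Q F : Finset (Set P)) : Set (HP P) :=
  {ψ | ∃ f : Set P → HP P, (∀ S ∈ Q, LocalOn S (f S)) ∧
    (∀ S ∈ F, ∀ v ∈ LS L S, σ.toFun v *ᵥ f S = f S) ∧ ψ = ∏ S ∈ Q, f S}

theorem span_productStates_empty {Q : Finset (Set P)} (hcover : ∀ p : P, ∃ S ∈ Q, p ∈ S) :
    Submodule.span ℂ (productStates σ Q ∅) = ⊤ := by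
  refine eq_top_iff.2 fun ψ _ => ?_
  rw [pi_eq_sum_univ ψ]
  refine Submodule.sum_mem _ fun x _ => Submodule.smul_mem _ _ (Submodule.subset_span ?_)
  refine ⟨fun S u => if ∀ p ∈ S, x p = u p then 1 else 0, fun S _ u u' h => ?_, by simp, ?_⟩
  · have : (∀ p ∈ S, x p = u p) ↔ ∀ p ∈ S, x p = u' p :=
      forall₂_congr fun p hp => by rw [h p hp]
    simp only [this]
  · funext u
    rw [Finset.prod_apply, Finset.prod_boole]
    have : x = u ↔ ∀ S ∈ Q, ∀ p ∈ S, x p = u p := by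
      refine ⟨fun h _ _ _ _ => h ▸ rfl, fun h => funext fun p => ?_⟩
      obtain ⟨S, hS, hp⟩ := hcover p
      exact h S hS p hp
    by_cases hxu : x = u
    · rw [if_pos hxu, if_pos (this.1 hxu)]
    · rw [if_neg hxu, if_neg fun h => hxu (this.2 h)]

theorem code_le_span_productStates {Q : Finset (Set P)}
    (hQ : (Q : Set (Set P)).PairwiseDisjoint id) (hcover : ∀ p : P, ∃ S ∈ Q, p ∈ S)
    {F : Finset (Set P)} (hF : F ⊆ Q) :
    code L σ ≤ Submodule.span ℂ (productStates σ Q F) := by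
  induction F using Finset.induction_on with
  | empty => simp [span_productStates_empty σ hcover]
  | insert T F hTF ih =>
    rw [Finset.insert_subset_iff] at hF
    intro ψ hψ
    have hmap : Submodule.span ℂ (productStates σ Q F) ≤
        (Submodule.span ℂ (productStates σ Q (insert T F))).comap
          (Matrix.mulVecLin (stabSum σ T)) := by
      refine Submodule.span_le.2 ?_
      rintro _ ⟨f, hloc, hfix, rfl⟩
      refine Submodule.subset_span ⟨Function.update f T (stabSum σ T *ᵥ f T), ?_, ?_, ?_⟩
      · intro S hS
        rcases eq_or_ne S T with rfl | hne
        · simpa using localOn_stabSum_mulVec σ (hloc S hS)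
        · simpa [hne] using hloc S hS
      · intro S hS v hv
        rcases eq_or_ne S T with rfl | hne
        · simp [Matrix.mulVec_mulVec, mul_stabSum σ hv]
        · simpa [hne] using hfix S (Finset.mem_of_mem_insert_of_ne hS hne) v hv
      · rw [Matrix.mulVecLin_apply, ← Finset.mul_prod_erase Q f hF.1,
          stabSum_mulVec_mul σ T _ (localOn_compl_prod_erase hQ hloc hF.1),
          ← Finset.mul_prod_erase Q _ hF.1, Function.update_self]
        congr 1
        refine Finset.prod_congr rfl fun S hS => ?_
        rw [Function.update_of_ne (Finset.ne_of_mem_erase hS)]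
    have h := hmap (ih hF.2 hψ)
    rw [Submodule.mem_comap, Matrix.mulVecLin_apply, stabSum_mulVec_of_mem_code σ T hψ] at h
    exact (Submodule.smul_mem_iff _ (Nat.cast_ne_zero.2 Fintype.card_ne_zero)).1 h

theorem mem_code_of_forall_parts {Q : Finset (Set P)}
    (hQ : (Q : Set (Set P)).PairwiseDisjoint id) (hcover : ∀ p : P, ∃ S ∈ Q, p ∈ S)
    (hsplit : ∀ S ∈ Q, SplitsOn L S) {ψ : HP P}
    (hψ : ∀ S ∈ Q, ∀ v ∈ LS L S, σ.toFun v *ᵥ ψ = ψ) : ψ ∈ code L σ := by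
  intro v hv
  have hsum : v = ∑ S ∈ Q, restrTo S v := by
    funext p
    obtain ⟨S, hS, hp⟩ := hcover p
    rw [Finset.sum_apply, Finset.sum_eq_single_of_mem S hS]
    · simp [restrTo, hp]
    · intro T hT hne
      exact if_neg (Set.disjoint_right.1 (hQ hT hS hne) hp)
  have key : (∑ S ∈ Q, restrTo S v) ∈ L ∧ σ.toFun (∑ S ∈ Q, restrTo S v) *ᵥ ψ = ψ := by
    refine Finset.sum_induction _ (fun w => w ∈ L ∧ σ.toFun w *ᵥ ψ = ψ) ?_ ?_ ?_
    · rintro a b ⟨ha, ha'⟩ ⟨hb, hb'⟩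
      exact ⟨L.add_mem ha hb, by
        rw [σ.mul_of_mem a ha b hb, ← Matrix.mulVec_mulVec, hb', ha']⟩
    · exact ⟨L.zero_mem, by rw [σ.map_zero, Matrix.one_mulVec]⟩
    · intro S hS
      have hmem := hsplit S hS v hv
      exact ⟨hmem, hψ S hS _ ⟨hmem, fun p hp => by simp [restrTo, hp]⟩⟩
  rw [hsum]
  exact key.2

theorem span_productStates_le_code {Q : Finset (Set P)}
    (hQ : (Q : Set (Set P)).PairwiseDisjoint id) (hcover : ∀ p : P, ∃ S ∈ Q, p ∈ S)
    (hsplit : ∀ S ∈ Q, SplitsOn L S) :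
    Submodule.span ℂ (productStates σ Q Q) ≤ code L σ := by
  refine Submodule.span_le.2 ?_
  rintro _ ⟨f, hloc, hfix, rfl⟩
  refine mem_code_of_forall_parts σ hQ hcover hsplit fun S hS v hv => ?_
  rw [← Finset.mul_prod_erase Q f hS,
    σ.mulVec_mul hv.2 _ (localOn_compl_prod_erase hQ hloc hS), hfix S hS v hv]

end Code

/-! ### Automorphisms -/

theorem adjRot_one : adjRot 1 = 1 := by
  ext i j
  fin_cases i <;> fin_cases j <;>
    simp [adjRot, pauliBasis, sigmaX, sigmaY, sigmaZ, Matrix.trace, Matrix.mul_apply,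
      Fin.sum_univ_two] <;> norm_num

theorem exists_smul_one_of_adjRot_eq_one {u : Matrix (Fin 2) (Fin 2) ℂ}
    (hu : u ∈ Matrix.unitaryGroup (Fin 2) ℂ) (h : adjRot u = 1) :
    ∃ c : ℂ, c ≠ 0 ∧ u = c • 1 := by
  have h2 := congrFun (congrFun h 2) 2
  have h0 := congrFun (congrFun h 0) 0
  have hu' := Matrix.mem_unitaryGroup_iff.1 hu
  have e0 := congrArg Complex.re (congrFun (congrFun hu' 0) 0)
  have e1 := congrArg Complex.re (congrFun (congrFun hu' 1) 1)
  simp [adjRot, pauliBasis, sigmaX, sigmaZ, Matrix.trace, Matrix.mul_apply,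
    Fin.sum_univ_two] at h2 h0 e0 e1
  have off : Complex.normSq (u 0 1) + Complex.normSq (u 1 0) = 0 := by
    simp only [Complex.normSq_apply]
    linarith
  have h01 : u 0 1 = 0 := Complex.normSq_eq_zero.1 <| by
    linarith [Complex.normSq_nonneg (u 0 1), Complex.normSq_nonneg (u 1 0)]
  have h10 : u 1 0 = 0 := Complex.normSq_eq_zero.1 <| by
    linarith [Complex.normSq_nonneg (u 0 1), Complex.normSq_nonneg (u 1 0)]
  simp only [h01, h10, Complex.zero_re, Complex.zero_im] at h0 e0 e1
  have h11 : u 1 1 = u 0 0 := by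
    refine sub_eq_zero.1 (Complex.normSq_eq_zero.1 ?_)
    simp only [Complex.normSq_apply, Complex.sub_re, Complex.sub_im]
    linarith
  refine ⟨u 0 0, fun h00 => ?_, ?_⟩
  · simp [h00] at e0
  · ext i j
    fin_cases i <;> fin_cases j <;> simp [h01, h10, h11]

theorem exists_locOp_smul {P : Type} [Fintype P] {u : P → Matrix (Fin 2) (Fin 2) ℂ} (S : Set P)
    (hu : ∀ p, u p ∈ Matrix.unitaryGroup (Fin 2) ℂ) (h : ∀ p ∉ S, adjRot (u p) = 1) :
    ∃ c : ℂ, c ≠ 0 ∧ locOp u = c • locOp fun p => if p ∈ S then u p else 1 := by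
  have : ∀ p, ∃ c : ℂ, c ≠ 0 ∧ u p = c • if p ∈ S then u p else 1 := by
    intro p
    by_cases hp : p ∈ S
    · exact ⟨1, one_ne_zero, by simp [hp]⟩
    · simpa [hp] using exists_smul_one_of_adjRot_eq_one (hu p) (h p hp)
  choose c hc hcu using this
  exact ⟨∏ p, c p, Finset.prod_ne_zero_iff.2 fun p _ => hc p, by
    rw [← locOp_smul]; exact congrArg locOp (funext hcu)⟩

theorem locOp_mulVec_injective {u : P → Matrix (Fin 2) (Fin 2) ℂ}
    (hu : ∀ p, u p ∈ Matrix.unitaryGroup (Fin 2) ℂ) :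
    Function.Injective (locOp u *ᵥ ·) := by
  have hinv : locOp (fun p => star (u p)) * locOp u = 1 := by
    rw [locOp_mul, ← locOp_one]
    exact congrArg locOp (funext fun p => Matrix.mem_unitaryGroup_iff'.1 (hu p))
  intro ψ φ h
  have := congrArg (locOp (fun p => star (u p)) *ᵥ ·) h
  simpa [Matrix.mulVec_mulVec, hinv] using this

section Aut

variable {L : Submodule (ZMod 2) (QV P)} (σ : PauliSection L)

theorem ite_mem_unitaryGroup {P : Type} {u : P → Matrix (Fin 2) (Fin 2) ℂ}
    (hu : ∀ p, u p ∈ Matrix.unitaryGroup (Fin 2) ℂ) (S : Set P) (p : P) :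
    (if p ∈ S then u p else 1) ∈ Matrix.unitaryGroup (Fin 2) ℂ := by
  split_ifs
  · exact hu p
  · exact one_mem _

theorem restrict_mem_autSet {S : Set P} (hS : SplitsOn L S) {g : P → Rot}
    (hg : g ∈ autSet L σ) : (fun p => if p ∈ S then g p else 1) ∈ autSet L σ := by
  obtain ⟨u, hu, hug, hcode⟩ := hg
  refine ⟨fun p => if p ∈ S then u p else 1, ite_mem_unitaryGroup hu S, fun p => ?_, ?_⟩
  · by_cases hp : p ∈ S <;> simp [hp, hug p, adjRot_one]
  intro ψ hψ v hv
  have hfac : locOp u = locOp (fun p => if p ∈ S then 1 else u p) *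
      locOp (fun p => if p ∈ S then u p else 1) := by
    rw [locOp_mul]
    congr 1
    funext p
    by_cases hp : p ∈ S <;> simp [hp]
  have hin : σ.toFun (restrTo S v) *ᵥ (locOp (fun p => if p ∈ S then u p else 1) *ᵥ ψ) =
      locOp (fun p => if p ∈ S then u p else 1) *ᵥ ψ := by
    have hk : ∀ p, (if p ∈ S then 1 else u p) ∈ Matrix.unitaryGroup (Fin 2) ℂ := fun p => by
      split_ifs
      exacts [one_mem _, hu p]
    apply locOp_mulVec_injective hk
    have hcomm := σ.commute_locOp (S := S) (v := restrTo S v)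
      (g := fun p => if p ∈ S then 1 else u p)
      (fun p hp => by simp [restrTo, hp]) (fun p hp => if_pos hp)
    change locOp _ *ᵥ (_ *ᵥ _) = locOp _ *ᵥ _
    rw [Matrix.mulVec_mulVec, ← hcomm, ← Matrix.mulVec_mulVec, Matrix.mulVec_mulVec ψ,
      ← hfac]
    exact hcode ψ hψ _ (hS v hv)
  have hout : σ.toFun (restrTo Sᶜ v) *ᵥ (locOp (fun p => if p ∈ S then u p else 1) *ᵥ ψ) =
      locOp (fun p => if p ∈ S then u p else 1) *ᵥ ψ := by
    have hcomm := σ.commute_locOp (S := Sᶜ) (v := restrTo Sᶜ v)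
      (g := fun p => if p ∈ S then u p else 1)
      (fun p hp => by simp_all [restrTo]) (fun p hp => if_neg hp)
    rw [Matrix.mulVec_mulVec, hcomm, ← Matrix.mulVec_mulVec, hψ _ (hS.compl v hv)]
  have hv' : v = restrTo S v + restrTo Sᶜ v := by
    funext p
    by_cases hp : p ∈ S <;> simp [restrTo, hp]
  rw [hv', σ.mul_of_mem _ (hS v hv) _ (hS.compl v hv), ← Matrix.mulVec_mulVec, hout, hin]

theorem mem_autSet_of_forall_parts {Q : Finset (Set P)}
    (hQ : (Q : Set (Set P)).PairwiseDisjoint id) (hcover : ∀ p : P, ∃ S ∈ Q, p ∈ S)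
    {g : P → Rot} (hg : ∀ S ∈ Q, (fun p => if p ∈ S then g p else 1) ∈ autSet L σ) :
    g ∈ autSet L σ := by
  have key : ∀ F ⊆ Q, ∃ u : P → Matrix (Fin 2) (Fin 2) ℂ,
      (∀ p, u p ∈ Matrix.unitaryGroup (Fin 2) ℂ) ∧
      (∀ S ∈ F, ∀ p ∈ S, adjRot (u p) = g p) ∧ (∀ p, (∀ S ∈ F, p ∉ S) → u p = 1) ∧
      ∀ ψ ∈ code L σ, locOp u *ᵥ ψ ∈ code L σ := by
    intro F
    induction F using Finset.induction_on with
    | empty =>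
      intro _
      refine ⟨fun _ => 1, fun _ => one_mem _, by simp, fun _ _ => rfl, fun ψ hψ => ?_⟩
      rwa [locOp_one, Matrix.one_mulVec]
    | insert T F hTF ih =>
      intro hF
      rw [Finset.insert_subset_iff] at hF
      obtain ⟨u, hu, hug, hu1, hcode⟩ := ih hF.2
      obtain ⟨w, hw, hwg, hwcode⟩ := hg T hF.1
      have hdisj : ∀ S ∈ F, ∀ p ∈ S, p ∉ T := fun S hS p hp =>
        Set.disjoint_left.1 (hQ (hF.2 hS) hF.1 fun h => hTF (h ▸ hS)) hp
      obtain ⟨c, hc, hcw⟩ := exists_locOp_smul T hw fun p hp => (hwg p).trans (if_neg hp)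
      refine ⟨fun p => (if p ∈ T then w p else 1) * u p,
        fun p => mul_mem (ite_mem_unitaryGroup hw T p) (hu p), ?_, ?_, ?_⟩
      · intro S hS p hp
        rcases Finset.mem_insert.1 hS with rfl | hS
        · beta_reduce
          rw [if_pos hp, hu1 p fun S' hS' hp' => hdisj S' hS' p hp' hp, mul_one]
          exact (hwg p).trans (if_pos hp)
        · beta_reduce
          rw [if_neg (hdisj S hS p hp), one_mul, hug S hS p hp]
      · intro p hp
        beta_reduce
        rw [if_neg (hp T (Finset.mem_insert_self _ _)), one_mul,
          hu1 p fun S hS => hp S (Finset.mem_insert_of_mem hS)]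
      · intro ψ hψ
        have h := hwcode _ (hcode ψ hψ)
        rw [hcw, Matrix.smul_mulVec, Submodule.smul_mem_iff _ hc, Matrix.mulVec_mulVec,
          locOp_mul] at h
        exact h
  obtain ⟨u, hu, hug, -, hcode⟩ := key Q subset_rfl
  refine ⟨u, hu, fun p => ?_, hcode⟩
  obtain ⟨S, hS, hp⟩ := hcover p
  exact hug S hS p hp

end Aut


/-- **Unique decomposition into indecomposables.** Every isotropic `L ⊆ V^P` has a
unique representation `L = ∏_{S ∈ parts} L_S` where `parts` is a partition of `P` and each
factor is indecomposable; moreover the code decomposes as the tensor product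
`C(L, σ) = ⊗_{S ∈ parts} C(L_S, σ|_{L_S})` (the span of products of componentwise code
states) and the automorphism group decomposes as the product
`A(L, σ) = ∏_{S ∈ parts} A(L_S, σ|_{L_S})`. -/
theorem unique_decomposition {P : Type} [Fintype P] [DecidableEq P]
    (L : Submodule (ZMod 2) (QV P)) (hL : Isotropic L) (σ : PauliSection L) :
    ∃ parts : Set (Set P),
      (Setoid.IsPartition parts ∧ ∀ S ∈ parts, SplitsOn L S ∧ IndecompWithin L S) ∧
      (∀ parts' : Set (Set P),
        (Setoid.IsPartition parts' ∧ ∀ S ∈ parts', SplitsOn L S ∧ IndecompWithin L S) →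
        parts' = parts) ∧
      code L σ = Submodule.span ℂ
        {ψ : HP P | ∃ f : Set P → HP P,
          (∀ S ∈ parts,
            (∀ v ∈ LS L S, σ.toFun v *ᵥ f S = f S) ∧
            ∀ u u' : P → Fin 2, (∀ p ∈ S, u p = u' p) → f S u = f S u') ∧
          ψ = fun u => ∏ᶠ S ∈ parts, f S u} ∧
      autSet L σ =
        {g | ∀ S ∈ parts, (fun p => if p ∈ S then g p else 1) ∈ autSet L σ} := by
  have hpart := Setoid.isPartition_classes (inseparableSetoid L)
  have hparts : ∀ S ∈ (inseparableSetoid L).classes, SplitsOn L S ∧ IndecompWithin L S := by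
    rintro _ ⟨p, rfl⟩
    exact ⟨splitsOn_inseparable_class L p, indecompWithin_inseparable_class L p⟩
  obtain ⟨Q, hQeq⟩ := (Set.toFinite (inseparableSetoid L).classes).exists_finset_coe
  have hQ : (Q : Set (Set P)).PairwiseDisjoint id := hQeq ▸ hpart.pairwiseDisjoint
  have hcover : ∀ p : P, ∃ S ∈ Q, p ∈ S := fun p => by
    obtain ⟨S, ⟨hS, hp⟩, -⟩ := hpart.2 p
    rw [← hQeq] at hS
    exact ⟨S, hS, hp⟩
  refine ⟨(inseparableSetoid L).classes, ⟨hpart, hparts⟩,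
    fun parts' h => eq_classes_of_isPartition h.1 h.2, ?_, ?_⟩
  · rw [← hQeq] at hparts ⊢
    refine ((code_le_span_productStates σ hQ hcover subset_rfl).antisymm
      (span_productStates_le_code σ hQ hcover fun S hS => (hparts S hS).1)).trans ?_
    congr 1
    ext ψ
    refine exists_congr fun f => ?_
    have hprod : (fun u => ∏ᶠ S ∈ (Q : Set (Set P)), f S u) = ∏ S ∈ Q, f S := by
      funext u
      rw [finprod_mem_coe_finset, Finset.prod_apply]
    rw [hprod, ← and_assoc]
    refine and_congr_left fun _ => ?_
    exact ⟨fun h S hS => ⟨h.2 S hS, h.1 S hS⟩,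
      fun h => ⟨fun S hS => (h S hS).2, fun S hS => (h S hS).1⟩⟩
  · ext g
    refine ⟨fun hg S hS => restrict_mem_autSet σ (hparts S hS).1 hg, fun hg => ?_⟩
    rw [← hQeq] at hg
    exact mem_autSet_of_forall_parts σ hQ hcover hg

end Stab
end
end
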